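/- For a circular language L over a finite alphabet A, the following three conditions are equivalent: (1) there exists a (1,3)-complete circular splicing system S = (A,I,R) such that L = L(S); (2) there exists a flat splicing system S' = (A, Y, R') with Y ⊆ A^+ a finite language closed under the conjugacy relation and R' = {(a,1,1,b) : a,b ∈ A}, such that the language generated by S' equals Lin(L); (3) there exists a finite language Y ⊆ A^+ closed under the conjugacy relation such that Lin(L) = Y^{←*} \ {1}. -/

import Mathlib

/-- Conjugacy of words: `w` and `w'` are conjugate iff `w = x ++ y` and `w' = y ++ x`. -/
def WordConj {A : Type*} (w w' : List A) : Prop :=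
  ∃ x y : List A, w = x ++ y ∧ w' = y ++ x

/-- A flat splicing rule `(α, β, γ, δ)`; its components are called handles. -/
structure FlatRule (A : Type*) where
  α : List A
  β : List A
  γ : List A
  δ : List A

/-- One flat splicing step: applying the rule `(α,β,γ,δ)` to `u = xαβy` and
`v = γzδ` produces `w = xαγzδβy`. -/
def FlatStep {A : Type*} (R : Set (FlatRule A)) (L : Set (List A)) (w : List A) : Prop :=
  ∃ r ∈ R, ∃ x y z : List A,
    x ++ r.α ++ r.β ++ y ∈ L ∧ r.γ ++ z ++ r.δ ∈ L ∧
    w = x ++ r.α ++ r.γ ++ z ++ r.δ ++ r.β ++ y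

/-- The language generated by the flat splicing system `(A, I, R)`: the smallest
language containing `I` and closed under all productions by rules of `R`. -/
def FlatLang {A : Type*} (I : Set (List A)) (R : Set (FlatRule A)) : Set (List A) :=
  ⋂₀ {L : Set (List A) | I ⊆ L ∧ ∀ w, FlatStep R L w → w ∈ L}

/-- One (1,3)-CSSH splicing step (at the level of full linearizations): the rule
`(a, b)` (that is, `a#1$b#1`) splices circular words `~(x a)` and `~(y b)` into
`~(x a y b)`. -/
def CSSHStep {A : Type*} (R : Set (A × A)) (L : Set (List A)) (w : List A) : Prop :=
  ∃ (a b : A) (x y : List A), (a, b) ∈ R ∧ x ++ [a] ∈ L ∧ y ++ [b] ∈ L ∧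
    WordConj w (x ++ [a] ++ y ++ [b])

/-- The full linearization of the circular language generated by the (1,3)-CSSH system
`(A, ~I, R)`, where `I` is a linearization of the initial circular language. -/
def CSSHLang {A : Type*} (I : Set (List A)) (R : Set (A × A)) : Set (List A) :=
  ⋂₀ {L : Set (List A) |
      (∀ w ∈ I, ∀ w', WordConj w w' → w' ∈ L) ∧ ∀ w, CSSHStep R L w → w ∈ L}

/-- The flat rules `(a, 1, 1, b)` associated with a set `R` of pairs of letters. -/
def insRules {A : Type*} (R : Set (A × A)) : Set (FlatRule A) :=
  {r | ∃ a b : A, (a, b) ∈ R ∧ r = ⟨[a], [], [], [b]⟩}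

/-- One insertion step: `w` is obtained from `u` by inserting a word of `Y`. -/
def InsStep {A : Type*} (Y : Set (List A)) (u w : List A) : Prop :=
  ∃ u1 u2 y : List A, y ∈ Y ∧ u = u1 ++ u2 ∧ w = u1 ++ y ++ u2

/-- The derivation quasi-order `≤_Y`: reflexive-transitive closure of `⇒_Y`. -/
def DerivLE {A : Type*} (Y : Set (List A)) : List A → List A → Prop :=
  Relation.ReflTransGen (InsStep Y)

/-- The pure unitary language of the pure unitary grammar `(A, Y)`:
all words derivable from the empty word. -/
def unitaryLang {A : Type*} (Y : Set (List A)) : Set (List A) :=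
  {w | DerivLE Y [] w}

/-- Iterated insertion: `Y^{←0} = {1}` and `Y^{←(i+1)} = Y^{←i} ← Y`. -/
def iterIns {A : Type*} (Y : Set (List A)) : ℕ → Set (List A)
  | 0 => {[]}
  | i + 1 => {w | ∃ z ∈ iterIns Y i, InsStep Y z w}

/-- `Y^{←*} = ⋃_{i ≥ 0} Y^{←i}`. -/
def iterInsStar {A : Type*} (Y : Set (List A)) : Set (List A) :=
  ⋃ i, iterIns Y i

section Helpers
variable {A : Type}

theorem wordConj_iff (w w' : List A) : WordConj w w' ↔ w ~r w' := by
  constructor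
  · rintro ⟨x, y, rfl, rfl⟩
    exact List.isRotated_append
  · rintro ⟨n, rfl⟩
    exact ⟨w.take (n % w.length), w.drop (n % w.length), (List.take_append_drop _ _).symm,
      List.rotate_eq_drop_append_take_mod⟩

theorem star_ind {Y : Set (List A)} {P : List A → Prop} (h0 : P [])
    (hs : ∀ u1 u2 y, u1 ++ u2 ∈ iterInsStar Y → P (u1 ++ u2) → y ∈ Y → P (u1 ++ y ++ u2)) :
    ∀ w ∈ iterInsStar Y, P w := by
  have key : ∀ i, ∀ w ∈ iterIns Y i, P w := by
    intro i
    induction i with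
    | zero =>
      intro w hw
      have : w = [] := hw
      rw [this]; exact h0
    | succ i ih =>
      rintro w ⟨z, hz, u1, u2, y, hy, rfl, rfl⟩
      exact hs u1 u2 y (Set.mem_iUnion.2 ⟨i, hz⟩) (ih _ hz) hy
  intro w hw
  obtain ⟨i, hi⟩ := Set.mem_iUnion.1 hw
  exact key i w hi

theorem star_nil (Y : Set (List A)) : [] ∈ iterInsStar Y :=
  Set.mem_iUnion.2 ⟨0, rfl⟩

theorem star_step {Y : Set (List A)} {u1 u2 y : List A} (h : u1 ++ u2 ∈ iterInsStar Y)
    (hy : y ∈ Y) : u1 ++ y ++ u2 ∈ iterInsStar Y := by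
  obtain ⟨i, hi⟩ := Set.mem_iUnion.1 h
  exact Set.mem_iUnion.2 ⟨i + 1, _, hi, u1, u2, y, hy, rfl, rfl⟩

theorem star_base {Y : Set (List A)} {y : List A} (hy : y ∈ Y) : y ∈ iterInsStar Y := by
  have := star_step (u1 := []) (u2 := []) (star_nil Y) hy
  simpa using this

theorem star_ins {Y : Set (List A)} {z1 z2 : List A} (h : z1 ++ z2 ∈ iterInsStar Y) :
    ∀ v ∈ iterInsStar Y, z1 ++ v ++ z2 ∈ iterInsStar Y := by
  apply star_ind
  · simpa using h
  · intro u1 u2 y _ ih hy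
    have := star_step (u1 := z1 ++ u1) (u2 := u2 ++ z2) (y := y) (by simpa using ih) hy
    simpa using this

theorem star_conj {Y : Set (List A)} (hY : ∀ w ∈ Y, ∀ w', WordConj w w' → w' ∈ Y) :
    ∀ w ∈ iterInsStar Y, ∀ p q, w = p ++ q → q ++ p ∈ iterInsStar Y := by
  apply star_ind
  · intro p q h
    have h' := List.append_eq_nil_iff.1 h.symm
    rw [h'.1, h'.2]; exact star_nil Y
  · intro u1 u2 y _ ih hy p q h
    rw [List.append_assoc] at h
    rcases List.append_eq_append_iff.1 h with ⟨c, rfl, h2⟩ | ⟨c, rfl, rfl⟩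
    · rcases List.append_eq_append_iff.1 h2 with ⟨d, rfl, rfl⟩ | ⟨d, rfl, rfl⟩
      · have h3 := ih (u1 ++ d) q (by simp)
        have := star_step (u1 := q ++ u1) (u2 := d) (y := y) (by simpa using h3) hy
        simpa using this
      · have h3 := ih u1 u2 rfl
        have h4 : d ++ c ∈ iterInsStar Y := star_base (hY _ hy _ ⟨c, d, rfl, rfl⟩)
        have := star_ins h4 _ h3
        simpa using this
    · have h3 := ih p (c ++ u2) (by simp)
      have := star_step (u1 := c) (u2 := u2 ++ p) (y := y) (by simpa using h3) hy
      simpa using this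

theorem cssh_base {Y : Set (List A)} {R : Set (A × A)} {w w' : List A} (hw : w ∈ Y)
    (h : WordConj w w') : w' ∈ CSSHLang Y R :=
  Set.mem_sInter.2 fun _ hM => hM.1 w hw w' h

theorem cssh_step {Y : Set (List A)} {R : Set (A × A)} {w : List A}
    (h : CSSHStep R (CSSHLang Y R) w) : w ∈ CSSHLang Y R := by
  refine Set.mem_sInter.2 fun M hM => hM.2 w ?_
  obtain ⟨a, b, x, y, hR, hx, hy, hc⟩ := h
  exact ⟨a, b, x, y, hR, Set.mem_sInter.1 hx M hM, Set.mem_sInter.1 hy M hM, hc⟩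

theorem cssh_conj {Y : Set (List A)} {R : Set (A × A)} {w w' : List A}
    (hw : w ∈ CSSHLang Y R) (h : WordConj w w') : w' ∈ CSSHLang Y R := by
  have : w ∈ {w | ∀ w', w ~r w' → w' ∈ CSSHLang Y R} := by
    refine Set.mem_sInter.1 hw _ ⟨?_, ?_⟩
    · intro v hv v' hvv' v'' h2
      refine cssh_base hv ((wordConj_iff _ _).2 ?_)
      exact ((wordConj_iff _ _).1 hvv').trans h2
    · rintro v ⟨a, b, x, y, hR, hx, hy, hc⟩ v' h2
      refine cssh_step ⟨a, b, x, y, hR, hx _ (List.IsRotated.refl _),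
        hy _ (List.IsRotated.refl _), (wordConj_iff _ _).2 ?_⟩
      exact h2.symm.trans ((wordConj_iff _ _).1 hc)
  exact this w' ((wordConj_iff _ _).1 h)

theorem cssh_eq {Y : Set (List A)} (hne : ∀ y ∈ Y, y ≠ [])
    (hY : ∀ w ∈ Y, ∀ w', WordConj w w' → w' ∈ Y) :
    CSSHLang Y (Set.univ : Set (A × A)) = iterInsStar Y \ {[]} := by
  apply Set.Subset.antisymm
  · intro w hw
    refine Set.mem_sInter.1 hw _ ⟨?_, ?_⟩
    · intro v hv v' h
      have := hY v hv v' h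
      exact ⟨star_base this, hne _ this⟩
    · rintro v ⟨a, b, x, y, _, hx, hy, ⟨p, q, rfl, hc⟩⟩
      have h1 := star_ins (z1 := x ++ [a]) (z2 := []) (by simpa using hx.1) _ hy.1
      refine ⟨star_conj hY _ h1 q p (by simpa using hc), ?_⟩
      intro h
      have h' := List.append_eq_nil_iff.1 (show p ++ q = [] from h)
      simp [h'.1, h'.2] at hc
  · rintro w ⟨hw, hn⟩
    revert hn
    revert w
    refine star_ind (P := fun w => w ∉ ({[]} : Set (List A)) → w ∈ CSSHLang Y _) ?_ ?_
    · intro h; exact absurd rfl h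
    · intro u1 u2 y _ ih hy _
      have hyC : y ∈ CSSHLang Y (Set.univ : Set (A × A)) :=
        cssh_base hy ⟨y, [], by simp, by simp⟩
      by_cases h0 : u1 ++ u2 = []
      · have h' := List.append_eq_nil_iff.1 h0
        simpa [h'.1, h'.2] using hyC
      · have hu : u2 ++ u1 ∈ CSSHLang Y (Set.univ : Set (A × A)) :=
          cssh_conj (ih h0) ⟨u1, u2, rfl, rfl⟩
        have h1 : u2 ++ u1 ≠ [] := by
          intro h; apply h0
          have h' := List.append_eq_nil_iff.1 h
          simp [h'.1, h'.2]
        obtain ⟨x, a, hx⟩ := List.eq_nil_or_concat' (u2 ++ u1) |>.resolve_left h1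
        obtain ⟨z, b, hz⟩ := List.eq_nil_or_concat' y |>.resolve_left (hne y hy)
        refine cssh_step ⟨a, b, x, z, trivial, hx ▸ hu, hz ▸ hyC, u1 ++ y, u2, rfl, ?_⟩
        rw [← hx, List.append_assoc, ← hz]; simp

theorem flat_step {Y : Set (List A)} {u1 u2 v : List A} (h1 : u1 ≠ []) (h2 : v ≠ [])
    (hu : u1 ++ u2 ∈ FlatLang Y (insRules (Set.univ : Set (A × A))))
    (hv : v ∈ FlatLang Y (insRules (Set.univ : Set (A × A)))) :
    u1 ++ v ++ u2 ∈ FlatLang Y (insRules (Set.univ : Set (A × A))) := by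
  obtain ⟨x, a, rfl⟩ := List.eq_nil_or_concat' u1 |>.resolve_left h1
  obtain ⟨z, b, rfl⟩ := List.eq_nil_or_concat' v |>.resolve_left h2
  refine Set.mem_sInter.2 fun M hM => hM.2 _ ?_
  refine ⟨⟨[a], [], [], [b]⟩, ⟨a, b, trivial, rfl⟩, x, u2, z, ?_, ?_, ?_⟩
  · simpa using Set.mem_sInter.1 hu M hM
  · simpa using Set.mem_sInter.1 hv M hM
  · simp

theorem flat_eq {Y : Set (List A)} (hne : ∀ y ∈ Y, y ≠ []) :
    FlatLang Y (insRules (Set.univ : Set (A × A))) = iterInsStar Y \ {[]} := by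
  apply Set.Subset.antisymm
  · intro w hw
    refine Set.mem_sInter.1 hw _ ⟨fun y hy => ⟨star_base hy, hne y hy⟩, ?_⟩
    rintro v ⟨r, ⟨a, b, _, rfl⟩, x, y, z, hx, hz, rfl⟩
    refine ⟨?_, by simp⟩
    have := star_ins (z1 := x ++ [a]) (z2 := y) (by simpa using hx.1) _ hz.1
    simpa using this
  · rintro w ⟨hw, hn⟩
    revert hn
    revert w
    refine star_ind (P := fun w => w ∉ ({[]} : Set (List A)) → w ∈ FlatLang Y _) ?_ ?_
    · intro h; exact absurd rfl h
    · intro u1 u2 y _ ih hy _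
      have hyC : y ∈ FlatLang Y (insRules (Set.univ : Set (A × A))) :=
        Set.mem_sInter.2 fun M hM => hM.1 hy
      by_cases h1 : u1 = []
      · subst h1
        by_cases h2 : u2 = []
        · subst h2; simpa using hyC
        · have := flat_step (u1 := y) (u2 := []) (v := u2) (hne y hy) h2 (by simpa using hyC)
            (ih h2)
          simpa using this
      · exact flat_step h1 (hne y hy) (ih (by simp [h1])) hyC

end Helpers

/-- For a circular language `L` (given by its conjugacy-closed full linearization),
the following are equivalent: (1) `L` is generated by a (1,3)-complete circular
splicing system `(A, I, R)`; (2) `Lin(L)` is generated by a flat splicing system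
`(A, Y, R')` with `Y ⊆ A^+` finite and closed under conjugacy and
`R' = {(a,1,1,b) : a, b ∈ A}`; (3) `Lin(L) = Y^{←*} \ {1}` for some finite `Y ⊆ A^+`
closed under conjugacy. -/
theorem stmt16 {A : Type} [Fintype A] (L : Set (List A))
    (hL : ∀ w ∈ L, ∀ w', WordConj w w' → w' ∈ L) :
    ((∃ I : Set (List A), I.Finite ∧ [] ∉ I ∧
          (∀ w ∈ I, ∀ w', WordConj w w' → w' ∈ I) ∧
          L = CSSHLang I (Set.univ : Set (A × A))) ↔
        (∃ Y : Set (List A), Y.Finite ∧ (∀ y ∈ Y, y ≠ []) ∧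
          (∀ w ∈ Y, ∀ w', WordConj w w' → w' ∈ Y) ∧
          FlatLang Y (insRules (Set.univ : Set (A × A))) = L)) ∧
      ((∃ I : Set (List A), I.Finite ∧ [] ∉ I ∧
          (∀ w ∈ I, ∀ w', WordConj w w' → w' ∈ I) ∧
          L = CSSHLang I (Set.univ : Set (A × A))) ↔
        (∃ Y : Set (List A), Y.Finite ∧ (∀ y ∈ Y, y ≠ []) ∧
          (∀ w ∈ Y, ∀ w', WordConj w w' → w' ∈ Y) ∧
          L = iterInsStar Y \ {[]})) := by
  refine ⟨⟨?_, ?_⟩, ⟨?_, ?_⟩⟩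
  · rintro ⟨I, hf, h0, hc, rfl⟩
    have hne : ∀ y ∈ I, y ≠ [] := fun y hy h => h0 (h ▸ hy)
    exact ⟨I, hf, hne, hc, by rw [flat_eq hne, cssh_eq hne hc]⟩
  · rintro ⟨Y, hf, hne, hc, rfl⟩
    exact ⟨Y, hf, fun h => hne _ h rfl, hc, by rw [flat_eq hne, cssh_eq hne hc]⟩
  · rintro ⟨I, hf, h0, hc, rfl⟩
    have hne : ∀ y ∈ I, y ≠ [] := fun y hy h => h0 (h ▸ hy)
    exact ⟨I, hf, hne, hc, cssh_eq hne hc⟩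
  · rintro ⟨Y, hf, hne, hc, rfl⟩
    exact ⟨Y, hf, fun h => hne _ h rfl, hc, (cssh_eq hne hc).symm⟩
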